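/- Let r ≥ 1 and let v₀ ∈ ℝʳ be a point that is not contained in any proper affine subspace of ℝʳ defined over ℚ (i.e. the smallest affine subspace of ℝʳ containing v₀ and defined by equations with rational coefficients is ℝʳ itself). Let U ⊆ ℝʳ be an open convex neighborhood of v₀ and let f : U → ℝ be a concave function. Suppose there exists a positive integer M with the following property: for every rational point v ∈ U ∩ ℚʳ and every positive integer q with q·v ∈ ℤʳ, one has M·q·f(v) ∈ ℤ. Then f agrees with an affine function on some open neighborhood of v₀ in U. -/

import Mathlib

open Filter Topology MeasureTheory Metric Set

/-- A concave function on an open convex set has a supporting affine function at every point. -/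
theorem ConcaveOn.exists_le_add_clm {E : Type*} [NormedAddCommGroup E] [NormedSpace ℝ E]
    [FiniteDimensional ℝ E] {U : Set E} {f : E → ℝ} (hU : IsOpen U) (hf : ConcaveOn ℝ U f)
    {z : E} (hz : z ∈ U) : ∃ L : E →L[ℝ] ℝ, ∀ x ∈ U, f x ≤ f z + L (x - z) := by
  have hopen : IsOpen {p : E × ℝ | p.1 ∈ U ∧ p.2 < f p.1} := by
    have hcont : ContinuousOn (fun p : E × ℝ ↦ f p.1 - p.2) (Prod.fst ⁻¹' U) :=
      ((hf.continuousOn hU).comp continuousOn_fst fun _ h ↦ h).sub continuousOn_snd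
    convert hcont.isOpen_inter_preimage (hU.preimage continuous_fst)
      (isOpen_Ioi (a := (0 : ℝ))) using 1
    ext p
    simp
  obtain ⟨φ, hφ⟩ := geometric_hahn_banach_open_point hf.convex_strict_hypograph hopen
    (x := (z, f z)) (by simp)
  have hsplit (x : E) (t : ℝ) : φ (x, t) = φ (x, 0) + t * φ (0, 1) := by
    rw [← smul_eq_mul, ← map_smul, ← map_add]
    simp
  have hB : 0 < φ (0, 1) := by
    have := hφ (z, f z - 1) ⟨hz, by simp⟩
    rw [hsplit z (f z - 1), hsplit z (f z)] at this
    linarith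
  refine ⟨-(φ (0, 1))⁻¹ • φ.comp (ContinuousLinearMap.inl ℝ E ℝ), fun x hx ↦ ?_⟩
  have hle : φ (x, 0) + f x * φ (0, 1) ≤ φ (z, 0) + f z * φ (0, 1) := by
    refine le_of_forall_pos_lt_add fun ε hε ↦ ?_
    have := hφ (x, f x - ε / φ (0, 1)) ⟨hx, by simp; positivity⟩
    rw [hsplit x, hsplit z, sub_mul, div_mul_cancel₀ _ hB.ne'] at this
    linarith
  have hsub : φ (x - z, 0) = φ (x, 0) - φ (z, 0) := by
    rw [← map_sub]
    simp
  simp only [smul_apply, ContinuousLinearMap.comp_apply,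
    ContinuousLinearMap.inl_apply, hsub, smul_eq_mul]
  rw [← sub_le_iff_le_add', neg_mul, ← mul_neg, le_inv_mul_iff₀ hB]
  linarith

/-- Points lying in all the open orthants based at `x₀`, at coordinatewise distance at least `m`,
have a ball around `x₀` in their convex hull. -/
theorem ball_subset_convexHull_range_of_orthants {ι : Type*} [Fintype ι] {x₀ : ι → ℝ} {m : ℝ}
    {v : (ι → Bool) → ι → ℝ}
    (hv : ∀ s i, m ≤ (if s i then 1 else -1) * (v s i - x₀ i)) :
    ball x₀ m ⊆ convexHull ℝ (range v) := by
  classical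
  intro x hx
  by_contra hxc
  obtain ⟨φ, u, hφx, hφ⟩ := geometric_hahn_banach_point_closed (convex_convexHull ℝ (range v))
    ((finite_range v).isClosed_convexHull ℝ) hxc
  let c : ι → ℝ := fun i ↦ φ fun j ↦ if i = j then 1 else 0
  have hc (y : ι → ℝ) : φ y = ∑ i, y i * c i :=
    φ.toLinearMap.pi_apply_eq_sum_univ y
  let s : ι → Bool := fun i ↦ decide (c i < 0)
  have hs := hφx.trans (hφ (v s) (subset_convexHull ℝ _ (mem_range_self s)))
  rw [hc, hc] at hs
  refine hs.not_ge (Finset.sum_le_sum fun i _ ↦ ?_)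
  have hxi : |x i - x₀ i| < m := (dist_le_pi_dist x x₀ i).trans_lt hx
  have hsi := hv s i
  rw [abs_lt] at hxi
  by_cases hi : c i < 0
  · simp only [s, hi, decide_true, if_true] at hsi
    nlinarith
  · simp only [s, hi, decide_false] at hsi
    norm_num at hsi
    nlinarith

/-- The powers of a nontrivial complex number of norm one average out to zero. -/
theorem tendsto_average_pow_of_norm_eq_one {z : ℂ} (hz : ‖z‖ = 1) (hz1 : z ≠ 1) :
    Tendsto (fun N : ℕ ↦ (N : ℂ)⁻¹ * ∑ n ∈ Finset.range N, z ^ (n + 1)) atTop (𝓝 0) := by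
  have hbound (N : ℕ) : ‖∑ n ∈ Finset.range N, z ^ (n + 1)‖ ≤ 2 / ‖z - 1‖ := by
    simp_rw [pow_succ]
    rw [← Finset.sum_mul, geom_sum_eq hz1, norm_mul, hz, mul_one, norm_div]
    gcongr
    exact (norm_sub_le _ _).trans (by simp [hz]; norm_num)
  refine squeeze_zero_norm (a := fun N : ℕ ↦ (N : ℝ)⁻¹ * (2 / ‖z - 1‖)) (fun N ↦ ?_) ?_
  · rw [norm_mul, norm_inv, Complex.norm_natCast]
    gcongr
    exact hbound N
  · simpa using tendsto_inv_atTop_nhds_zero_nat.mul_const (2 / ‖z - 1‖)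

theorem UnitAddTorus.mFourier_add_apply {d : Type*} [Fintype d] (k : d → ℤ)
    (x y : UnitAddTorus d) :
    mFourier k (x + y) = mFourier k x * mFourier k y := by
  simp only [mFourier, ContinuousMap.coe_mk, Pi.add_apply, ← Finset.prod_mul_distrib]
  exact Finset.prod_congr rfl fun i _ ↦ by simp [fourier_apply, AddCircle.toCircle_add]

theorem UnitAddTorus.mFourier_nsmul_apply {d : Type*} [Fintype d] (k : d → ℤ)
    (x : UnitAddTorus d) (n : ℕ) : mFourier k (n • x) = mFourier k x ^ n := by
  induction n with
  | zero => simp [mFourier]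
  | succ n ih => rw [succ_nsmul, mFourier_add_apply, ih, pow_succ]

/-- **Weyl's equidistribution** for trigonometric polynomials. -/
theorem UnitAddTorus.tendsto_average_of_mem_span {d : Type*} [Fintype d]
    (μ : Measure (UnitAddTorus d)) [IsProbabilityMeasure μ] [μ.IsAddLeftInvariant]
    {θ : UnitAddTorus d} (hθ : ∀ k : d → ℤ, mFourier k θ = 1 → k = 0)
    {P : C(UnitAddTorus d, ℂ)} (hP : P ∈ Submodule.span ℂ (range (mFourier (d := d)))) :
    Tendsto (fun N : ℕ ↦ (N : ℂ)⁻¹ * ∑ n ∈ Finset.range N, P ((n + 1) • θ)) atTop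
      (𝓝 (∫ x, P x ∂μ)) := by
  have hint (g : C(UnitAddTorus d, ℂ)) : Integrable g μ :=
    g.continuous.integrable_of_hasCompactSupport (HasCompactSupport.of_compactSpace _)
  induction hP using Submodule.span_induction with
  | mem g hg =>
    obtain ⟨k, rfl⟩ := hg
    simp_rw [mFourier_nsmul_apply]
    by_cases hk : k = 0
    · subst hk
      refine tendsto_const_nhds.congr' ?_
      filter_upwards [eventually_ne_atTop 0] with N hN
      simp [mFourier_zero, hN]
    · have hz : mFourier k θ ≠ 1 := fun h ↦ hk (hθ k h)
      have hzn : ‖mFourier k θ‖ = 1 := by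
        simp only [mFourier, ContinuousMap.coe_mk, norm_prod, fourier_apply, Circle.norm_coe,
          Finset.prod_const_one]
      have hI : ∫ x, mFourier k x ∂μ = 0 := by
        have h := integral_add_left_eq_self (μ := μ) (fun x ↦ mFourier k x) θ
        simp_rw [mFourier_add_apply, integral_const_mul] at h
        by_contra hne
        exact hz ((mul_eq_right₀ hne).mp h)
      rw [hI]
      exact tendsto_average_pow_of_norm_eq_one hzn hz
  | zero => simp
  | add g h _ _ hg hh =>
    simp only [ContinuousMap.add_apply, Finset.sum_add_distrib, mul_add]
    rw [integral_add (hint g) (hint h)]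
    exact hg.add hh
  | smul c g _ hg =>
    simp only [ContinuousMap.smul_apply, smul_eq_mul, ← Finset.mul_sum, integral_const_mul,
      mul_left_comm _ c]
    exact hg.const_mul c

/-- **Kronecker's theorem** on the torus: the forward orbit of a point annihilated by no nontrivial
character is dense. -/
theorem UnitAddTorus.exists_nsmul_mem_ball {d : Type*} [Fintype d] {θ : UnitAddTorus d}
    (hθ : ∀ k : d → ℤ, mFourier k θ = 1 → k = 0) (a : UnitAddTorus d) {δ : ℝ} (hδ : 0 < δ) :
    ∃ q : ℕ, 0 < q ∧ q • θ ∈ ball a δ := by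
  by_contra! hmiss
  let μ : Measure (UnitAddTorus d) := Measure.addHaarMeasure ⊤
  have : IsProbabilityMeasure μ := ⟨Measure.addHaarMeasure_self⟩
  let g : C(UnitAddTorus d, ℝ) := ⟨fun x ↦ max 0 (δ - dist x a), by fun_prop⟩
  have hgint : 0 < ∫ x, g x ∂μ :=
    g.continuous.integral_pos_of_hasCompactSupport_nonneg_nonzero
      (HasCompactSupport.of_compactSpace _) (fun x ↦ le_max_left _ _) (x := a)
      (by simp [g, hδ])
  let h : C(UnitAddTorus d, ℂ) := ⟨fun x ↦ (g x : ℂ), by fun_prop⟩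
  have hh (n : ℕ) : h ((n + 1) • θ) = 0 := by
    have := hmiss (n + 1) n.succ_pos
    rw [mem_ball, not_lt] at this
    simpa [h, g] using this
  obtain ⟨P, hPmem, hP⟩ : ∃ P ∈ Submodule.span ℂ (range (mFourier (d := d))),
      dist h P < (∫ x, g x ∂μ) / 2 := by
    refine Metric.mem_closure_iff.mp ?_ _ (half_pos hgint)
    rw [← Submodule.topologicalClosure_coe, span_mFourier_closure_eq_top]
    trivial
  have hPh (x) : ‖P x - h x‖ ≤ dist h P := by
    rw [← dist_eq_norm, dist_comm]
    exact ContinuousMap.dist_apply_le_dist x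
  have hlim : ‖∫ x, P x ∂μ‖ ≤ dist h P := by
    refine le_of_tendsto (tendsto_average_of_mem_span μ hθ hPmem).norm
      (Eventually.of_forall fun N ↦ ?_)
    rcases N.eq_zero_or_pos with rfl | hN
    · simp
    rw [norm_mul, norm_inv, Complex.norm_natCast, inv_mul_le_iff₀ (by positivity)]
    refine (norm_sum_le_of_le (n := fun _ ↦ dist h P) _ fun n _ ↦ ?_).trans_eq (by simp)
    simpa [hh] using hPh ((n + 1) • θ)
  have hint (f : C(UnitAddTorus d, ℂ)) : Integrable f μ :=
    f.continuous.integrable_of_hasCompactSupport (HasCompactSupport.of_compactSpace _)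
  have hdiff : ‖∫ x, P x ∂μ - ∫ x, h x ∂μ‖ ≤ dist h P := by
    rw [← integral_sub (hint P) (hint h)]
    simpa using norm_integral_le_of_norm_le_const (μ := μ) (Eventually.of_forall hPh)
  have hnorm : ‖∫ x, h x ∂μ‖ = ∫ x, g x ∂μ := by
    simp only [h, ContinuousMap.coe_mk]
    rw [integral_complex_ofReal, Complex.norm_real, Real.norm_of_nonneg hgint.le]
  have := norm_sub_norm_le (∫ x, h x ∂μ) (∫ x, P x ∂μ)
  rw [norm_sub_rev] at this
  linarith

/-- **Kronecker's approximation theorem**, with a positive multiplier. -/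
theorem exists_nat_int_abs_sub_lt {d : Type*} [Fintype d] {θ : d → ℝ}
    (hθ : ∀ (k : d → ℤ) (m : ℤ), ∑ i, (k i : ℝ) * θ i = m → k = 0) (w : d → ℝ) {δ : ℝ}
    (hδ : 0 < δ) : ∃ (q : ℕ) (p : d → ℤ), 0 < q ∧ ∀ i, |p i - q * θ i - w i| < δ := by
  have hθ' (k : d → ℤ) (hk : UnitAddTorus.mFourier k (fun i ↦ (θ i : UnitAddCircle)) = 1) :
      k = 0 := by
    simp only [UnitAddTorus.mFourier, ContinuousMap.coe_mk, fourier_coe_apply,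
      ← Complex.exp_sum] at hk
    obtain ⟨m, hm⟩ := Complex.exp_eq_one_iff.mp hk
    refine hθ k m ?_
    have h2 : (2 * Real.pi * Complex.I : ℂ) ≠ 0 := Complex.two_pi_I_ne_zero
    have : ((∑ i, (k i : ℝ) * θ i : ℝ) : ℂ) = m := by
      apply mul_left_cancel₀ h2
      rw [mul_comm _ (m : ℂ), ← hm]
      push_cast
      rw [Finset.mul_sum]
      exact Finset.sum_congr rfl fun i _ ↦ by ring
    exact_mod_cast this
  obtain ⟨q, hq, hball⟩ := UnitAddTorus.exists_nsmul_mem_ball hθ'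
    (fun i ↦ ((-w i : ℝ) : UnitAddCircle)) hδ
  refine ⟨q, fun i ↦ round (q * θ i + w i), hq, fun i ↦ ?_⟩
  have h := (dist_le_pi_dist _ _ i).trans_lt hball
  have hcoe : (q • fun i ↦ (θ i : UnitAddCircle)) i - ((-w i : ℝ) : UnitAddCircle)
      = ((q * θ i + w i : ℝ) : UnitAddCircle) := by
    simp
  rw [dist_eq_norm, hcoe, UnitAddCircle.norm_eq, abs_sub_comm] at h
  rwa [sub_sub]


/-- Let `r ≥ 1` and let `v₀ ∈ ℝʳ` be a point not contained in any proper
affine subspace of `ℝʳ` defined over `ℚ` (encoded: the only rational affine equation it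
satisfies is the trivial one). Let `U` be an open convex neighborhood of `v₀` and `f` a
concave function on `U`. Suppose there is a positive integer `M` such that for every
rational point `v ∈ U` and every positive integer `q` with `q·v ∈ ℤʳ`, we have
`M·q·f(v) ∈ ℤ`. Then `f` agrees with an affine function on an open neighborhood of `v₀`. -/
theorem S_invariant_linear_near_irrational_point
    (r : ℕ) (hr : 1 ≤ r) (v₀ : Fin r → ℝ)
    (hirr : ∀ (c : Fin r → ℚ) (e : ℚ),
      (∑ i, (c i : ℝ) * v₀ i) = (e : ℝ) → c = 0)
    (U : Set (Fin r → ℝ)) (hUopen : IsOpen U) (hUconv : Convex ℝ U) (hv₀ : v₀ ∈ U)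
    (f : (Fin r → ℝ) → ℝ) (hconc : ConcaveOn ℝ U f)
    (M : ℕ) (hM : 0 < M)
    (hint : ∀ v ∈ U, (∀ i, ∃ a : ℚ, v i = (a : ℝ)) →
      ∀ q : ℕ, 0 < q → (∀ i, ∃ z : ℤ, (q : ℝ) * v i = (z : ℝ)) →
      ∃ z : ℤ, (M : ℝ) * (q : ℝ) * f v = (z : ℝ)) :
    ∃ V : Set (Fin r → ℝ), IsOpen V ∧ v₀ ∈ V ∧ V ⊆ U ∧
      ∃ (L : (Fin r → ℝ) →ₗ[ℝ] ℝ) (c : ℝ), ∀ v ∈ V, f v = L v + c := by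
  obtain ⟨ρ, hρ, K, hK, hball⟩ : ∃ ρ > 0, ∃ K ≥ 0, ∀ x ∈ ball v₀ ρ, x ∈ U ∧
      |f x - f v₀| ≤ K * ‖x - v₀‖ := by
    obtain ⟨K, t, ht, hKt⟩ := hconc.locallyLipschitzOn hUopen hv₀
    rw [hUopen.nhdsWithin_eq hv₀] at ht
    obtain ⟨ρ, hρ, hsub⟩ := Metric.mem_nhds_iff.mp (inter_mem ht (hUopen.mem_nhds hv₀))
    refine ⟨ρ, hρ, K, K.2, fun x hx ↦ ⟨(hsub hx).2, ?_⟩⟩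
    exact hKt.norm_sub_le (hsub hx).1 (hsub (mem_ball_self hρ)).1
  have hirr' (k : Fin r → ℤ) (m : ℤ) (h : ∑ i, (k i : ℝ) * v₀ i = m) : k = 0 := by
    have := hirr (fun i ↦ k i) m (by simpa using h)
    ext i
    simpa using congrFun this i
  let n : ℝ := Fintype.card (Fin r → Bool)
  obtain ⟨η, hη, hηρ, hηM⟩ : ∃ η > 0, 2 * η < ρ ∧ M * (2 * (K * (n * (2 * η)))) < 1 := by
    have h1 : ∀ᶠ η in 𝓝 (0 : ℝ), 2 * η < ρ :=
      (by fun_prop : Continuous fun η : ℝ ↦ 2 * η).tendsto' 0 0 (by simp) |>.eventually_lt_const hρ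
    have h2 : ∀ᶠ η in 𝓝 (0 : ℝ), M * (2 * (K * (n * (2 * η)))) < 1 :=
      (by fun_prop : Continuous fun η : ℝ ↦ M * (2 * (K * (n * (2 * η))))).tendsto' 0 0 (by simp)
        |>.eventually_lt_const one_pos
    obtain ⟨η, ⟨h1, h2⟩, hη⟩ := (((h1.and h2).filter_mono nhdsWithin_le_nhds).and
      (self_mem_nhdsWithin (a := (0 : ℝ)) (s := Ioi 0))).exists
    exact ⟨η, hη, h1, h2⟩
  choose q p hq hp using fun s : Fin r → Bool ↦ exists_nat_int_abs_sub_lt hirr'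
    (fun i ↦ (if s i then 1 else -1) * η) (half_pos hη)
  have hqR (s) : (0 : ℝ) < q s := Nat.cast_pos.mpr (hq s)
  have hq1 (s) : (1 : ℝ) ≤ q s := Nat.one_le_cast.mpr (hq s)
  -- The small vectors `w s = p s - q s • v₀` realize every sign pattern.
  let w : (Fin r → Bool) → Fin r → ℝ := fun s i ↦ p s i - q s * v₀ i
  have hw_norm (s) : ‖w s‖ ≤ 2 * η := by
    refine (pi_norm_le_iff_of_nonneg (by positivity)).mpr fun i ↦ ?_
    have h := abs_lt.mp (hp s i)
    rw [Real.norm_eq_abs, abs_le]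
    simp only [w]
    by_cases hs : s i <;> simp only [hs, if_true] at h <;> norm_num at h <;>
      constructor <;> linarith [h.1, h.2]
  have hw_sign (s i) : η / 2 ≤ (if s i then 1 else -1) * w s i := by
    have h := abs_lt.mp (hp s i)
    simp only [w]
    by_cases hs : s i <;> simp only [hs, if_true] at h ⊢ <;> norm_num at h ⊢ <;>
      linarith [h.1, h.2]
  let Q : ℕ := ∑ s, q s
  have hqQ (s) : q s ≤ Q := Finset.single_le_sum (fun _ _ ↦ Nat.zero_le _) (Finset.mem_univ s)
  have hQ : 0 < Q := (hq fun _ ↦ true).trans_le (hqQ _)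
  have hQR : (0 : ℝ) < Q := Nat.cast_pos.mpr hQ
  have hQsum : (Q : ℝ) = ∑ s, (q s : ℝ) := by simp [Q]
  let v : (Fin r → Bool) → Fin r → ℝ := fun s i ↦ p s i / q s
  let z : Fin r → ℝ := fun i ↦ (∑ s, p s i : ℤ) / Q
  have hv (s) : (q s : ℝ) • (v s - v₀) = w s := by
    ext i
    simp [v, w, mul_sub, mul_div_cancel₀ _ (hqR s).ne']
  have hz : (Q : ℝ) • (z - v₀) = ∑ s, w s := by
    ext i
    simp only [z, w, Pi.smul_apply, Pi.sub_apply, smul_eq_mul, mul_sub, Finset.sum_apply,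
      mul_div_cancel₀ _ hQR.ne', Finset.sum_sub_distrib, ← Finset.sum_mul, ← hQsum, Int.cast_sum]
  have hv_norm (s) : q s * ‖v s - v₀‖ ≤ 2 * η := by
    rw [← Real.norm_of_nonneg (hqR s).le, ← norm_smul, hv]
    exact hw_norm s
  have hv_ball (s) : v s ∈ ball v₀ ρ := by
    rw [mem_ball_iff_norm]
    nlinarith [hv_norm s, hq1 s, norm_nonneg (v s - v₀)]
  have hz_norm : Q * ‖z - v₀‖ ≤ n * (2 * η) := by
    rw [← Real.norm_of_nonneg hQR.le, ← norm_smul, hz]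
    exact (norm_sum_le_of_le _ fun s _ ↦ hw_norm s).trans_eq (by simp [n])
  have hz_eq : z = ∑ s, ((q s : ℝ) / Q) • v s := by
    ext i
    simp only [z, v, Finset.sum_apply, Pi.smul_apply, smul_eq_mul, Int.cast_sum, Finset.sum_div]
    exact Finset.sum_congr rfl fun s _ ↦ by
      have := (hqR s).ne'
      field_simp
  have hz_ball : z ∈ ball v₀ ρ := by
    rw [hz_eq]
    refine (convex_ball v₀ ρ).sum_mem (fun s _ ↦ by positivity) ?_ fun s _ ↦ hv_ball s
    rw [← Finset.sum_div, ← hQsum, div_self hQR.ne']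
  -- Integrality forces equality in the concavity inequality at `z`.
  have hdefect : (Q : ℝ) * f z = ∑ s, q s * f (v s) := by
    choose a ha using fun s ↦ hint (v s) (hball _ (hv_ball s)).1
      (fun i ↦ ⟨p s i / q s, by simp [v]⟩) (q s) (hq s)
      (fun i ↦ ⟨p s i, by simp [v, mul_div_cancel₀ _ (hqR s).ne']⟩)
    obtain ⟨b, hb⟩ := hint z (hball _ hz_ball).1
      (fun i ↦ ⟨(∑ s, p s i : ℤ) / Q, by simp [z]⟩) Q hQ
      (fun i ↦ ⟨∑ s, p s i, by simp only [z]; exact mul_div_cancel₀ _ hQR.ne'⟩)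
    have hMD : (M : ℝ) * (Q * f z - ∑ s, q s * f (v s)) = (b - ∑ s, a s : ℤ) := by
      push_cast
      rw [← hb, mul_sub, Finset.mul_sum]
      congr 1
      · ring
      · exact Finset.sum_congr rfl fun s _ ↦ by rw [← ha s]; ring
    have hsplit : Q * f z - ∑ s, q s * f (v s)
        = Q * (f z - f v₀) - ∑ s, q s * (f (v s) - f v₀) := by
      simp only [mul_sub, Finset.sum_sub_distrib, ← Finset.sum_mul, ← hQsum]
      ring
    have hz_le : |Q * (f z - f v₀)| ≤ K * (n * (2 * η)) := by
      rw [abs_mul, abs_of_pos hQR]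
      calc Q * |f z - f v₀| ≤ Q * (K * ‖z - v₀‖) := by gcongr; exact (hball _ hz_ball).2
        _ = K * (Q * ‖z - v₀‖) := by ring
        _ ≤ _ := by gcongr
    have hv_le : |∑ s, q s * (f (v s) - f v₀)| ≤ K * (n * (2 * η)) := by
      refine (Finset.abs_sum_le_sum_abs _ _).trans ?_
      calc ∑ s, |q s * (f (v s) - f v₀)| ≤ ∑ s : Fin r → Bool, K * (2 * η) := by
            refine Finset.sum_le_sum fun s _ ↦ ?_
            rw [abs_mul, abs_of_pos (hqR s)]
            calc q s * |f (v s) - f v₀| ≤ q s * (K * ‖v s - v₀‖) := by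
                  gcongr; exact (hball _ (hv_ball s)).2
              _ = K * (q s * ‖v s - v₀‖) := by ring
              _ ≤ _ := mul_le_mul_of_nonneg_left (hv_norm s) hK
        _ = _ := by simp [n]; ring
    have hlt : |(M : ℝ) * (Q * f z - ∑ s, q s * f (v s))| < 1 := by
      rw [abs_mul, Nat.abs_cast, hsplit]
      refine lt_of_le_of_lt ?_ hηM
      gcongr
      linarith [abs_sub (Q * (f z - f v₀)) (∑ s, q s * (f (v s) - f v₀))]
    have hb0 : b - ∑ s, a s = 0 := by
      rw [hMD] at hlt
      exact Int.abs_lt_one_iff.mp (by exact_mod_cast hlt)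
    rw [hb0, Int.cast_zero, mul_eq_zero, or_iff_right (by positivity)] at hMD
    exact sub_eq_zero.mp hMD
  obtain ⟨L, hL⟩ := hconc.exists_le_add_clm hUopen (hball z hz_ball).1
  have hvL (s) : f (v s) = f z + L (v s - z) := by
    have hsum : ∑ s, q s * (f z + L (v s - z) - f (v s)) = 0 := by
      have hLz : ∑ s, q s * L (v s - z) = 0 := by
        simp_rw [← smul_eq_mul, ← map_smul, ← map_sum]
        convert map_zero L
        have : ∑ s, (q s : ℝ) • (v s - z) = ∑ s, w s - (Q : ℝ) • (z - v₀) := by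
          rw [hQsum, Finset.sum_smul, ← Finset.sum_sub_distrib]
          refine Finset.sum_congr rfl fun s _ ↦ ?_
          rw [← hv, ← smul_sub, sub_sub_sub_cancel_right]
        rw [this, hz, sub_self]
      simp only [mul_sub, mul_add, Finset.sum_sub_distrib, Finset.sum_add_distrib, hLz,
        ← Finset.sum_mul, ← hQsum, hdefect]
      ring
    have h0 := (Finset.sum_eq_zero_iff_of_nonneg fun s _ ↦ mul_nonneg (hqR s).le
      (sub_nonneg.mpr (hL _ (hball _ (hv_ball s)).1))).mp hsum s (Finset.mem_univ s)
    rw [mul_eq_zero, or_iff_right (hqR s).ne'] at h0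
    linarith
  have hhull : ∀ x ∈ convexHull ℝ (range v), x ∈ U ∧ f z + L (x - z) ≤ f x := by
    have hconv : Convex ℝ {x | x ∈ U ∧ 0 ≤ f x - (f z + L (x - z))} := by
      refine ConcaveOn.convex_ge (hconc.sub ⟨hUconv, fun x _ y _ a b _ _ hab ↦ le_of_eq ?_⟩) 0
      have hz' : z = a • z + b • z := by rw [← add_smul, hab, one_smul]
      have : a • x + b • y - z = a • (x - z) + b • (y - z) := by
        conv_lhs => rw [hz']
        module
      rw [this, map_add, map_smul, map_smul]
      simp only [smul_eq_mul]
      linear_combination (-f z) * hab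
    intro x hx
    obtain ⟨h1, h2⟩ := convexHull_min (by
      rintro _ ⟨s, rfl⟩
      exact ⟨(hball _ (hv_ball s)).1, by rw [← hvL, sub_self]⟩) hconv hx
    exact ⟨h1, sub_nonneg.mp h2⟩
  have hsub : ball v₀ (η / 2 / Q) ⊆ convexHull ℝ (range v) := by
    refine ball_subset_convexHull_range_of_orthants fun s i ↦ ?_
    have hvi : v s i - v₀ i = w s i / q s := by
      rw [eq_div_iff (hqR s).ne', ← hv]
      simp [mul_comm]
    rw [hvi, ← mul_div_assoc]
    exact div_le_div₀ ((half_pos hη).le.trans (hw_sign s i)) (hw_sign s i) (hqR s)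
      (Nat.cast_le.mpr (hqQ s))
  refine ⟨ball v₀ (η / 2 / Q), isOpen_ball, mem_ball_self (by positivity),
    fun x hx ↦ (hhull x (hsub hx)).1, L.toLinearMap, f z - L z, fun x hx ↦ ?_⟩
  obtain ⟨hxU, hxL⟩ := hhull x (hsub hx)
  have := le_antisymm (hL x hxU) hxL
  rw [this, map_sub]
  simp only [ContinuousLinearMap.coe_coe]
  ring
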